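/- Let E be a measurable space, p ∈ (0,1), α a finite measure on E, and let φ, θ : E → ℂ be bounded measurable. Then for every bounded measurable F : Conf(E) → ℂ and every finite configuration η, writing D(η) := ∑_{x∈η} θ(x)(∫_E conj(φ(y)) F(η − x + y) α(dy) + ∑_{y∈η} conj(φ(y)) F(η − x + y)): (a) (k⁻(φ)(k⁺(θ)F))(η) = D(η) + F(η)(∫_E conj(φ)θ dα + ∑_{y∈η} conj(φ(y))θ(y)); and (b) (k⁺(θ)(k⁻(φ)F))(η) = D(η) − F(η) ∑_{x∈η} conj(φ(x))θ(x). -/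

import Mathlib

open MeasureTheory Complex

noncomputable section

variable {E : Type*}

/-- Number of points of the finite configuration `η` lying in `B`, counted with multiplicity. -/
def confCount (η : Multiset E) (B : Set E) : ℕ :=
  @Multiset.countP E (fun x => x ∈ B) (Classical.decPred _) η

/-- Removal of one copy of the point `x` from the configuration `η`. -/
def confDel (η : Multiset E) (x : E) : Multiset E :=
  @Multiset.erase E (Classical.decEq E) η x

/-- The σ-algebra on the configuration space generated by the counting maps `η ↦ η(B)`,
`B` measurable. -/
instance confMeasurableSpace [MeasurableSpace E] : MeasurableSpace (Multiset E) :=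
  MeasurableSpace.generateFrom
    {S | ∃ (B : Set E) (n : ℕ), MeasurableSet B ∧ S = {η | confCount η B = n}}

/-- The raising operator `k⁺(φ)`. -/
def kplus (p : ℝ) (φ : E → ℂ) (F : Multiset E → ℂ) (η : Multiset E) : ℂ :=
  (Real.sqrt p : ℂ)⁻¹ * (η.map (fun x => φ x * F (confDel η x))).sum

/-- The lowering operator `k⁻(φ)`. -/
def kminus (p : ℝ) [MeasurableSpace E] (α : Measure E) (φ : E → ℂ) (F : Multiset E → ℂ)
    (η : Multiset E) : ℂ :=
  (Real.sqrt p : ℂ) * ((∫ x, (starRingEnd ℂ) (φ x) * F (x ::ₘ η) ∂α) +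
    (η.map (fun x => (starRingEnd ℂ) (φ x) * F (x ::ₘ η))).sum)

/-- The neutral operator `k⁰(φ)`. -/
def kzero [MeasurableSpace E] (α : Measure E) (φ : E → ℂ) (F : Multiset E → ℂ)
    (η : Multiset E) : ℂ :=
  F η * ((η.map φ).sum + (1 / 2 : ℂ) * ∫ x, φ x ∂α)


/-- Adding a fixed configuration to a variable point is measurable. -/
lemma measurable_cons_left [MeasurableSpace E] (ξ : Multiset E) :
    Measurable (fun y : E => y ::ₘ ξ) := by
  refine measurable_generateFrom ?_
  rintro _ ⟨B, n, hB, rfl⟩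
  have h : ∀ y, confCount (y ::ₘ ξ) B = confCount ξ B + B.indicator (fun _ => 1) y := by
    intro y
    classical
    simp only [confCount, Multiset.countP_cons, Set.indicator_apply]
  have hm : Measurable (fun y => confCount ξ B + B.indicator (fun _ => 1) y) :=
    measurable_const.add (measurable_const.indicator hB)
  have hS : (fun y => y ::ₘ ξ) ⁻¹' {η | confCount η B = n} =
      (fun y => confCount ξ B + B.indicator (fun _ => 1) y) ⁻¹' {n} := by
    ext y
    change confCount (y ::ₘ ξ) B = n ↔ _ = n
    rw [h]
  rw [hS]
  exact hm (measurableSet_singleton n)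

lemma integrable_multiset_sum {X ι : Type*} [MeasurableSpace X] {μ : Measure X}
    (s : Multiset ι) (f : ι → X → ℂ) (hf : ∀ i, Integrable (f i) μ) :
    Integrable (fun x => (s.map (fun i => f i x)).sum) μ := by
  induction s using Multiset.induction with
  | empty => simp
  | cons a s ih =>
    simp only [Multiset.map_cons, Multiset.sum_cons]
    exact (hf a).add ih

lemma integral_multiset_sum {X ι : Type*} [MeasurableSpace X] {μ : Measure X}
    (s : Multiset ι) (f : ι → X → ℂ) (hf : ∀ i, Integrable (f i) μ) :
    ∫ x, (s.map (fun i => f i x)).sum ∂μ = (s.map (fun i => ∫ x, f i x ∂μ)).sum := by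
  induction s using Multiset.induction with
  | empty => simp
  | cons a s ih =>
    simp only [Multiset.map_cons, Multiset.sum_cons]
    rw [integral_add (hf a) (integrable_multiset_sum s f hf), ih]

/-- Product of bounded measurable functions is integrable for a finite measure. -/
lemma integrable_mul_of_bounded {X : Type*} [MeasurableSpace X] {μ : Measure X}
    [IsFiniteMeasure μ] {f g : X → ℂ} (hf : Measurable f) (hfb : ∃ C, ∀ x, ‖f x‖ ≤ C)
    (hg : Measurable g) (hgb : ∃ C, ∀ x, ‖g x‖ ≤ C) :
    Integrable (fun x => f x * g x) μ := by
  obtain ⟨C, hC⟩ := hfb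
  obtain ⟨K, hK⟩ := hgb
  refine Integrable.of_bound (hf.mul hg).aestronglyMeasurable (C * K) (ae_of_all _ fun x => ?_)
  rw [norm_mul]
  exact mul_le_mul (hC x) (hK x) (norm_nonneg _) ((norm_nonneg _).trans (hC x))

lemma cons_confDel {η : Multiset E} {x : E} (hx : x ∈ η) : x ::ₘ confDel η x = η :=
  @Multiset.cons_erase E (Classical.decEq E) η x hx

lemma confDel_cons_self (η : Multiset E) (y : E) : confDel (y ::ₘ η) y = η :=
  @Multiset.erase_cons_head E (Classical.decEq E) y η

lemma confDel_cons_of_mem {η : Multiset E} {x : E} (hx : x ∈ η) (y : E) :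
    confDel (y ::ₘ η) x = y ::ₘ confDel η x := by
  conv_lhs => rw [← cons_confDel hx, Multiset.cons_swap]
  exact confDel_cons_self _ _

lemma kplus_cons (p : ℝ) (θ : E → ℂ) (F : Multiset E → ℂ) (η : Multiset E) (y : E) :
    kplus p θ F (y ::ₘ η) = (Real.sqrt p : ℂ)⁻¹ *
      (θ y * F η + (η.map (fun x => θ x * F (y ::ₘ confDel η x))).sum) := by
  simp only [kplus, Multiset.map_cons, Multiset.sum_cons, confDel_cons_self]
  congr 3
  exact Multiset.map_congr rfl fun x hx => by rw [confDel_cons_of_mem hx]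

lemma sum_map_confDel {η : Multiset E} {x : E} (hx : x ∈ η) (g : E → ℂ) :
    ((confDel η x).map g).sum = (η.map g).sum - g x := by
  conv_rhs => rw [← cons_confDel hx]
  simp

/-- explicit formulas for `k⁻(φ)k⁺(θ)` and `k⁺(θ)k⁻(φ)`. -/
theorem kminus_kplus_explicit [MeasurableSpace E] (p : ℝ) (hp : p ∈ Set.Ioo (0 : ℝ) 1)
    (α : Measure E) [IsFiniteMeasure α]
    (φ θ : E → ℂ) (hφ : Measurable φ) (hφb : ∃ C, ∀ x, ‖φ x‖ ≤ C)
    (hθ : Measurable θ) (hθb : ∃ C, ∀ x, ‖θ x‖ ≤ C)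
    (F : Multiset E → ℂ) (hF : Measurable F) (hFb : ∃ C, ∀ η, ‖F η‖ ≤ C)
    (η : Multiset E)
    (D : ℂ)
    (hD : D = (η.map (fun x => θ x *
        ((∫ y, (starRingEnd ℂ) (φ y) * F (y ::ₘ confDel η x) ∂α) +
          (η.map (fun y => (starRingEnd ℂ) (φ y) * F (y ::ₘ confDel η x))).sum))).sum) :
    kminus p α φ (kplus p θ F) η
        = D + F η * ((∫ y, (starRingEnd ℂ) (φ y) * θ y ∂α) +
            (η.map (fun y => (starRingEnd ℂ) (φ y) * θ y)).sum)
      ∧ kplus p θ (kminus p α φ F) η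
        = D - F η * (η.map (fun x => (starRingEnd ℂ) (φ x) * θ x)).sum := by
  have hc : (Real.sqrt p : ℂ) ≠ 0 := by
    exact_mod_cast (Real.sqrt_pos.2 hp.1).ne'
  have hφ' : Measurable (fun y => (starRingEnd ℂ) (φ y)) := continuous_conj.measurable.comp hφ
  have hφb' : ∃ C, ∀ y, ‖(starRingEnd ℂ) (φ y)‖ ≤ C := by simpa using hφb
  have hint : ∀ ξ : Multiset E, Integrable (fun y => (starRingEnd ℂ) (φ y) * F (y ::ₘ ξ)) α :=
    fun ξ => integrable_mul_of_bounded hφ' hφb' (hF.comp (measurable_cons_left ξ))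
      (hFb.imp fun _ h y => h _)
  have hint' : Integrable (fun y => (starRingEnd ℂ) (φ y) * θ y) α :=
    integrable_mul_of_bounded hφ' hφb' hθ hθb
  constructor
  · have hk : ∀ y, (starRingEnd ℂ) (φ y) * kplus p θ F (y ::ₘ η) = (Real.sqrt p : ℂ)⁻¹ *
        (F η * ((starRingEnd ℂ) (φ y) * θ y) + (η.map (fun x => θ x *
          ((starRingEnd ℂ) (φ y) * F (y ::ₘ confDel η x)))).sum) := by
      intro y
      have hcomm : ∀ x, θ x * ((starRingEnd ℂ) (φ y) * F (y ::ₘ confDel η x)) =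
          (starRingEnd ℂ) (φ y) * (θ x * F (y ::ₘ confDel η x)) := fun x => by ring
      simp only [hcomm]
      rw [kplus_cons, Multiset.sum_map_mul_left]
      ring
    have hθint : ∀ x, Integrable (fun y => θ x *
        ((starRingEnd ℂ) (φ y) * F (y ::ₘ confDel η x))) α := fun x => (hint _).const_mul _
    simp only [kminus, hk]
    rw [integral_const_mul, integral_add (hint'.const_mul _) (integrable_multiset_sum η _ hθint),
      integral_const_mul, integral_multiset_sum η _ hθint, Multiset.sum_map_mul_left,
      Multiset.sum_map_add, Multiset.sum_map_mul_left, Multiset.sum_map_sum_map, ← mul_add,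
      mul_inv_cancel_left₀ hc, hD]
    simp only [mul_add, Multiset.sum_map_add, Multiset.sum_map_mul_left, integral_const_mul]
    ring
  · have hk : ∀ x ∈ η, θ x * kminus p α φ F (confDel η x) = (Real.sqrt p : ℂ) *
        (θ x * ((∫ y, (starRingEnd ℂ) (φ y) * F (y ::ₘ confDel η x) ∂α) +
          (η.map (fun y => (starRingEnd ℂ) (φ y) * F (y ::ₘ confDel η x))).sum) -
          F η * ((starRingEnd ℂ) (φ x) * θ x)) := by
      intro x hx
      rw [kminus, sum_map_confDel hx, cons_confDel hx]
      ring
    rw [kplus, Multiset.map_congr rfl hk, Multiset.sum_map_mul_left, inv_mul_cancel_left₀ hc,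
      Multiset.sum_map_sub, Multiset.sum_map_mul_left, hD]
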